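/- Work in the Clifford algebra Cl(2,0,1). For θ, x₀, y₀ ∈ ℝ define the rotator T := cos(θ/2)·1 + sin(θ/2)·P(x₀,y₀). Then T is a rotor (T · reverse(T) = 1) and for all x, y ∈ ℝ, T * P(x,y) * reverse(T) = P(x', y') where x' = x₀ + cos(θ)·(x - x₀) + sin(θ)·(y - y₀) and y' = y₀ - sin(θ)·(x - x₀) + cos(θ)·(y - y₀); that is, the sandwich X ↦ T X T̃ is the euclidean rotation about the point (x₀, y₀) through angle θ (with the orientation convention induced by this Clifford algebra). -/

import Mathlib

noncomputable section

/-- The quadratic form of signature (2,0,1) on `ℝ³`: `Q (x₀,x₁,x₂) = x₁² + x₂²`. -/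
def Q201 : QuadraticForm ℝ (Fin 3 → ℝ) := QuadraticMap.weightedSumSquares ℝ ![0, 1, 1]

/-- The canonical embedding of vectors into `Cl(2,0,1)`. -/
def ι2 : (Fin 3 → ℝ) →ₗ[ℝ] CliffordAlgebra Q201 := CliffordAlgebra.ι Q201

/-- The standard basis vectors `e₀, e₁, e₂` of `ℝ³`. -/
def eV (i : Fin 3) : Fin 3 → ℝ := Pi.single i 1

/-- Basis bivector `E₀ = e₁e₂`. -/
def E₀ : CliffordAlgebra Q201 := ι2 (eV 1) * ι2 (eV 2)

/-- Basis bivector `E₁ = e₂e₀`. -/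
def E₁ : CliffordAlgebra Q201 := ι2 (eV 2) * ι2 (eV 0)

/-- Basis bivector `E₂ = e₀e₁`. -/
def E₂ : CliffordAlgebra Q201 := ι2 (eV 0) * ι2 (eV 1)

/-- The euclidean point `(x,y)` as a normalized bivector of `Cl(2,0,1)`. -/
def Pt (x y : ℝ) : CliffordAlgebra Q201 := E₀ + x • E₁ + y • E₂

theorem ι2_eV_mul_self (i : Fin 3) :
    ι2 (eV i) * ι2 (eV i) = algebraMap ℝ (CliffordAlgebra Q201) ((![0, 1, 1] : Fin 3 → ℝ) i) := by
  rw [ι2, CliffordAlgebra.ι_sq_scalar]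
  congr 1
  fin_cases i <;> simp [Q201, eV, QuadraticMap.weightedSumSquares_apply, Fin.sum_univ_three]

theorem ι2_eV_zero_mul_self : ι2 (eV 0) * ι2 (eV 0) = 0 := by
  simp [ι2_eV_mul_self]

theorem ι2_eV_one_mul_self : ι2 (eV 1) * ι2 (eV 1) = 1 := by
  simp [ι2_eV_mul_self]

theorem ι2_eV_two_mul_self : ι2 (eV 2) * ι2 (eV 2) = 1 := by
  simp [ι2_eV_mul_self]

theorem ι2_eV_mul_comm {i j : Fin 3} (h : i ≠ j) :
    ι2 (eV i) * ι2 (eV j) = -(ι2 (eV j) * ι2 (eV i)) := by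
  refine CliffordAlgebra.ι_mul_ι_comm_of_isOrtho ?_
  rw [QuadraticMap.isOrtho_def]
  fin_cases i <;> fin_cases j <;>
    simp_all [Q201, eV, QuadraticMap.weightedSumSquares_apply, Fin.sum_univ_three]

theorem ι2_eV_two_mul_one : ι2 (eV 2) * ι2 (eV 1) = -(ι2 (eV 1) * ι2 (eV 2)) :=
  ι2_eV_mul_comm (by decide)

theorem ι2_eV_two_mul_zero : ι2 (eV 2) * ι2 (eV 0) = -(ι2 (eV 0) * ι2 (eV 2)) :=
  ι2_eV_mul_comm (by decide)

theorem ι2_eV_one_mul_zero : ι2 (eV 1) * ι2 (eV 0) = -(ι2 (eV 0) * ι2 (eV 1)) :=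
  ι2_eV_mul_comm (by decide)

theorem ι2_eV_mul_left_comm {i j : Fin 3} (h : i ≠ j) (a : CliffordAlgebra Q201) :
    ι2 (eV i) * (ι2 (eV j) * a) = -(ι2 (eV j) * (ι2 (eV i) * a)) := by
  rw [← mul_assoc, ι2_eV_mul_comm h, neg_mul, mul_assoc]

theorem ι2_eV_zero_mul_self_mul (a : CliffordAlgebra Q201) :
    ι2 (eV 0) * (ι2 (eV 0) * a) = 0 := by
  rw [← mul_assoc, ι2_eV_zero_mul_self, zero_mul]

theorem ι2_eV_one_mul_self_mul (a : CliffordAlgebra Q201) :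
    ι2 (eV 1) * (ι2 (eV 1) * a) = a := by
  rw [← mul_assoc, ι2_eV_one_mul_self, one_mul]

theorem E₀_mul_E₀ : E₀ * E₀ = -1 := by
  simp [E₀, mul_assoc, ι2_eV_mul_left_comm (i := 2) (j := 1) (by decide), ι2_eV_one_mul_self,
    ι2_eV_two_mul_self]

theorem E₀_mul_E₁ : E₀ * E₁ = -E₂ := by
  simp [E₀, E₁, E₂, mul_assoc, ι2_eV_one_mul_zero, ι2_eV_two_mul_zero,
    ι2_eV_mul_left_comm (i := 2) (j := 0) (by decide), ι2_eV_two_mul_self]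

theorem E₁_mul_E₀ : E₁ * E₀ = E₂ := by
  simp [E₀, E₁, E₂, mul_assoc, ι2_eV_two_mul_zero,
    ι2_eV_mul_left_comm (i := 2) (j := 1) (by decide), ι2_eV_two_mul_self]

theorem E₀_mul_E₂ : E₀ * E₂ = E₁ := by
  simp [E₀, E₁, E₂, mul_assoc, ι2_eV_two_mul_zero, ι2_eV_two_mul_one,
    ι2_eV_mul_left_comm one_ne_zero, ι2_eV_mul_left_comm (i := 2) (j := 0) (by decide),
    ι2_eV_one_mul_self_mul]

theorem E₂_mul_E₀ : E₂ * E₀ = -E₁ := by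
  simp [E₀, E₁, E₂, mul_assoc, ι2_eV_two_mul_zero, ι2_eV_one_mul_self_mul]

theorem E₁_mul_E₁ : E₁ * E₁ = 0 := by
  simp [E₁, mul_assoc, ι2_eV_two_mul_zero, ι2_eV_mul_left_comm (i := 2) (j := 0) (by decide),
    ι2_eV_zero_mul_self, ι2_eV_two_mul_self]

theorem E₂_mul_E₂ : E₂ * E₂ = 0 := by
  simp [E₂, mul_assoc, ι2_eV_mul_left_comm one_ne_zero, ι2_eV_zero_mul_self, ι2_eV_one_mul_self]

theorem E₁_mul_E₂ : E₁ * E₂ = 0 := by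
  simp [E₁, E₂, mul_assoc, ι2_eV_two_mul_zero, ι2_eV_two_mul_one,
    ι2_eV_mul_left_comm (i := 2) (j := 0) (by decide), ι2_eV_zero_mul_self_mul]

theorem E₂_mul_E₁ : E₂ * E₁ = 0 := by
  simp [E₁, E₂, mul_assoc, ι2_eV_two_mul_zero, ι2_eV_mul_left_comm one_ne_zero,
    ι2_eV_zero_mul_self_mul]

theorem reverse_ι2_mul_ι2 {i j : Fin 3} (h : i ≠ j) :
    CliffordAlgebra.reverse (ι2 (eV i) * ι2 (eV j)) = -(ι2 (eV i) * ι2 (eV j)) := by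
  rw [CliffordAlgebra.reverse.map_mul, ι2_eV_mul_comm h, neg_neg]
  simp only [ι2, CliffordAlgebra.reverse_ι]

theorem reverse_Pt (x y : ℝ) : CliffordAlgebra.reverse (Pt x y) = -Pt x y := by
  have h₀ : CliffordAlgebra.reverse E₀ = -E₀ := reverse_ι2_mul_ι2 (by decide)
  have h₁ : CliffordAlgebra.reverse E₁ = -E₁ := reverse_ι2_mul_ι2 (by decide)
  have h₂ : CliffordAlgebra.reverse E₂ = -E₂ := reverse_ι2_mul_ι2 (by decide)
  simp only [Pt, map_add, map_smul, h₀, h₁, h₂]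
  module

theorem E₁_mul_Pt (x y : ℝ) : E₁ * Pt x y = E₂ := by
  simp [Pt, mul_add, E₁_mul_E₀, E₁_mul_E₁, E₁_mul_E₂]

theorem E₂_mul_Pt (x y : ℝ) : E₂ * Pt x y = -E₁ := by
  simp [Pt, mul_add, E₂_mul_E₀, E₂_mul_E₁, E₂_mul_E₂]

theorem Pt_mul_Pt (x y x' y' : ℝ) :
    Pt x y * Pt x' y' = -1 + (y' - y) • E₁ + (x - x') • E₂ := by
  rw [Pt, add_mul, add_mul, smul_mul_assoc, smul_mul_assoc, E₁_mul_Pt, E₂_mul_Pt]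
  simp only [Pt, mul_add, mul_smul_comm, E₀_mul_E₀, E₀_mul_E₁, E₀_mul_E₂]
  module

/-- The rotator `T = cos(θ/2) + sin(θ/2)·P(x₀,y₀)` is a rotor whose sandwich rotates
every point about `(x₀,y₀)` through the angle `θ`. -/
theorem rotator_is_rotation (θ x₀ y₀ : ℝ) :
    let T : CliffordAlgebra Q201 :=
      Real.cos (θ / 2) • (1 : CliffordAlgebra Q201) + Real.sin (θ / 2) • Pt x₀ y₀
    T * CliffordAlgebra.reverse T = 1 ∧
      ∀ x y : ℝ, T * Pt x y * CliffordAlgebra.reverse T =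
        Pt (x₀ + Real.cos θ * (x - x₀) + Real.sin θ * (y - y₀))
           (y₀ - Real.sin θ * (x - x₀) + Real.cos θ * (y - y₀)) := by
  intro T
  have hT : CliffordAlgebra.reverse T =
      Real.cos (θ / 2) • (1 : CliffordAlgebra Q201) - Real.sin (θ / 2) • Pt x₀ y₀ := by
    simp only [T, map_add, map_smul, CliffordAlgebra.reverse.map_one, reverse_Pt, smul_neg,
      sub_eq_add_neg]
  have hcos : Real.cos θ = Real.cos (θ / 2) ^ 2 - Real.sin (θ / 2) ^ 2 := by
    rw [← Real.cos_two_mul', mul_div_cancel₀ θ two_ne_zero]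
  have hsin : Real.sin θ = 2 * Real.sin (θ / 2) * Real.cos (θ / 2) := by
    rw [← Real.sin_two_mul, mul_div_cancel₀ θ two_ne_zero]
  have hone := Real.sin_sq_add_cos_sq (θ / 2)
  rw [hT, hcos, hsin]
  simp only [T]
  generalize Real.cos (θ / 2) = c at *
  generalize Real.sin (θ / 2) = s at *
  constructor
  · simp only [add_mul, mul_sub, smul_mul_assoc, mul_smul_comm, one_mul, mul_one, Pt_mul_Pt]
    linear_combination (norm := module) hone • (1 : CliffordAlgebra Q201)
  · intro x y
    simp only [add_mul, mul_sub, smul_mul_assoc, mul_smul_comm, one_mul, mul_one, Pt_mul_Pt,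
      neg_mul, E₁_mul_Pt, E₂_mul_Pt]
    simp only [Pt]
    linear_combination (norm := module) hone • (E₀ + x₀ • E₁ + y₀ • E₂)

end
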